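/- arXiv:2604.20751 — 4 statements merged into one kernel-verified Lean document; each statement's English description precedes it below -/
import Mathlib

section
/- Let k ≥ 1 be an integer, let Σ = diag(σ₁, …, σ_k) be a real diagonal k×k matrix with σ₁ ≥ σ₂ ≥ … ≥ σ_k ≥ 0, let v ∈ ℝ^k, and let p ≥ 0. Form the (k+1)×(k+1) upper-triangular block matrix Ȳ = [[Σ, v], [0, p]]. If μ₁ ≥ μ₂ ≥ … ≥ μ_{k+1} denote the singular values of Ȳ (the nonnegative square roots of the eigenvalues of ȲᵀȲ, listed in nonincreasing order), then the interlacing inequalities μ_{k+1} ≤ σ_k ≤ μ_k ≤ σ_{k−1} ≤ … ≤ σ₁ ≤ μ₁ hold; that is, μ_{i+1} ≤ σ_i ≤ μ_i for every 1 ≤ i ≤ k. -/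
open Polynomial Matrix

lemma exists_common_zero {n α : Type*} [Fintype n] [Fintype α] [DecidableEq α]
    (L : (n → ℝ) →ₗ[ℝ] (α → ℝ)) (S : Finset n) (T : Finset α)
    (h : S.card + T.card < Fintype.card n) :
    ∃ x : n → ℝ, x ≠ 0 ∧ (∀ i ∈ S, x i = 0) ∧ ∀ j ∈ T, L x j = 0 := by
  let F : (n → ℝ) →ₗ[ℝ] ((S → ℝ) × (T → ℝ)) :=
    LinearMap.prod (LinearMap.pi fun i => LinearMap.proj i.1)
      (LinearMap.pi fun j => (LinearMap.proj j.1).comp L)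
  have hk : LinearMap.ker F ≠ ⊥ := by
    apply LinearMap.ker_ne_bot_of_finrank_lt
    simpa using h
  obtain ⟨x, hx, hx0⟩ := (Submodule.ne_bot_iff _).1 hk
  refine ⟨x, hx0, ?_, ?_⟩
  · intro i hi
    have := congrFun (congrArg Prod.fst (LinearMap.mem_ker.1 hx)) ⟨i, hi⟩
    simpa [F] using this
  · intro j hj
    have := congrFun (congrArg Prod.snd (LinearMap.mem_ker.1 hx)) ⟨j, hj⟩
    simpa [F] using this

lemma exists_diag {n : Type*} [Fintype n] [DecidableEq n] {m : ℕ} (A : Matrix n n ℝ)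
    (hA : A.IsHermitian) (d : Fin m → ℝ)
    (hchar : A.charpoly = ∏ i, (X - C (d i))) :
    ∃ L : (n → ℝ) →ₗ[ℝ] (Fin m → ℝ),
      (∀ x, ∑ j, (L x j) ^ 2 = ∑ j, x j ^ 2) ∧
      ∀ x, ∑ j, d j * (L x j) ^ 2 = x ⬝ᵥ (A *ᵥ x) := by
  have hm : Multiset.map d Finset.univ.val = Multiset.map hA.eigenvalues Finset.univ.val := by
    have h1 := hA.roots_charpoly_eq_eigenvalues
    have h2 : ∏ i, (X - C (d i)) = ((Multiset.map d Finset.univ.val).map fun a => X - C a).prod := by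
      rw [Multiset.map_map]; rfl
    rw [hchar, h2, Polynomial.roots_multiset_prod_X_sub_C] at h1
    simpa using h1
  obtain ⟨e, he⟩ : ∃ e : Fin m ≃ n, ∀ j, hA.eigenvalues (e j) = d j := by
    have hc : ∀ c : ℝ, Nonempty ({a // d a = c} ≃ {b // hA.eigenvalues b = c}) := by
      intro c
      have h3 := congrArg (Multiset.count c) hm
      rw [Multiset.count_map, Multiset.count_map] at h3
      refine ⟨Fintype.equivOfCardEq ?_⟩
      rw [Fintype.card_subtype, Fintype.card_subtype]
      simp only [eq_comm (a := c)] at h3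
      exact h3
    exact ⟨Equiv.ofFiberEquiv fun c => (hc c).some, fun j => Equiv.ofFiberEquiv_map _ j⟩
  let U : Matrix n n ℝ := hA.eigenvectorUnitary
  have hU : U * Uᵀ = 1 := by
    have := Unitary.coe_mul_star_self hA.eigenvectorUnitary
    simpa [U, star_eq_conjTranspose] using this
  have hAU : A = U * diagonal hA.eigenvalues * Uᵀ := by
    have := hA.spectral_theorem
    simpa [U, Unitary.conjStarAlgAut_apply, star_eq_conjTranspose, Function.comp_def] using this
  refine ⟨(LinearMap.funLeft ℝ ℝ e).comp (Matrix.mulVecLin Uᵀ), ?_, ?_⟩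
  · intro x
    have h1 : ∑ j, x j ^ 2 = (Uᵀ *ᵥ x) ⬝ᵥ (Uᵀ *ᵥ x) := by
      rw [Matrix.mulVec_transpose, ← Matrix.dotProduct_mulVec, ← Matrix.mulVec_transpose,
        Matrix.mulVec_mulVec, hU]
      simp [dotProduct, sq]
    rw [h1, dotProduct, ← e.sum_comp]
    simp [LinearMap.funLeft_apply, sq, Matrix.mulVec_transpose]
  · intro x
    have h1 : x ⬝ᵥ (A *ᵥ x) = (Uᵀ *ᵥ x) ⬝ᵥ (diagonal hA.eigenvalues *ᵥ (Uᵀ *ᵥ x)) := by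
      conv_lhs => rw [hAU]
      rw [← Matrix.mulVec_mulVec, ← Matrix.mulVec_mulVec, Matrix.dotProduct_mulVec,
        ← Matrix.mulVec_transpose]
    rw [h1, dotProduct, ← e.sum_comp]
    refine Finset.sum_congr rfl fun j _ => ?_
    simp [LinearMap.funLeft_apply, Matrix.mulVec_diagonal, he, Matrix.mulVec_transpose]
    ring

lemma sum_sq_pos' {n : Type*} [Fintype n] {x : n → ℝ} (hx : x ≠ 0) : 0 < ∑ j, x j ^ 2 := by
  obtain ⟨i, hi⟩ := Function.ne_iff.1 hx
  exact Finset.sum_pos' (fun _ _ => sq_nonneg _) ⟨i, Finset.mem_univ _, by simpa using sq_pos_of_ne_zero hi⟩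

/-- interlacing of the singular values of the bordered matrix
`Ȳ = [[Σ, v], [0, p]]` with the diagonal entries of `Σ`:
`μ_{i+1} ≤ σ_i ≤ μ_i` for every `1 ≤ i ≤ k`. Singular values are encoded as a
nonincreasing nonnegative family `μ` such that the `μ i ^ 2` are the
eigenvalues (with multiplicity) of `ȲᵀȲ`, expressed via the characteristic
polynomial. -/
theorem singular_value_interlacing
    (k : ℕ) (hk : 1 ≤ k)
    (σ : Fin k → ℝ) (hσmono : Antitone σ) (hσ0 : ∀ i, 0 ≤ σ i)
    (v : Fin k → ℝ) (p : ℝ) (hp : 0 ≤ p)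
    (Y : Matrix (Fin k ⊕ Fin 1) (Fin k ⊕ Fin 1) ℝ)
    (hY : Y = Matrix.fromBlocks (Matrix.diagonal σ)
        (Matrix.of fun i (_ : Fin 1) => v i) 0
        (Matrix.of fun (_ : Fin 1) (_ : Fin 1) => p))
    (μ : Fin (k + 1) → ℝ) (hμmono : Antitone μ) (hμ0 : ∀ i, 0 ≤ μ i)
    (hchar : (Yᵀ * Y).charpoly = ∏ i : Fin (k + 1), (X - C (μ i ^ 2))) :
    ∀ i : Fin k, μ i.succ ≤ σ i ∧ σ i ≤ μ i.castSucc := by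
  have hA : (Yᵀ * Y).IsHermitian := by
    simpa using Matrix.isHermitian_conjTranspose_mul_self Y
  obtain ⟨L, hL1, hL2⟩ := exists_diag (Yᵀ * Y) hA (fun i => μ i ^ 2) hchar
  have hQ : ∀ x : Fin k ⊕ Fin 1 → ℝ, x (Sum.inr 0) = 0 →
      x ⬝ᵥ ((Yᵀ * Y) *ᵥ x) = ∑ j, σ j ^ 2 * x (Sum.inl j) ^ 2 := by
    intro x hx
    rw [← Matrix.mulVec_mulVec, Matrix.dotProduct_mulVec, ← Matrix.mulVec_transpose,
      Matrix.transpose_transpose]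
    have h1 : ∀ j, (Y *ᵥ x) (Sum.inl j) = σ j * x (Sum.inl j) := by
      intro j
      simp [hY, Matrix.mulVec, dotProduct, hx, Matrix.diagonal_apply]
    have h2 : (Y *ᵥ x) (Sum.inr 0) = 0 := by
      simp [hY, Matrix.mulVec, dotProduct, hx]
    simp [dotProduct, h1, h2]
    exact Finset.sum_congr rfl fun j _ => by ring
  intro i
  constructor
  · obtain ⟨x, hx0, hxS, hxT⟩ := exists_common_zero L
      (insert (Sum.inr 0) ((Finset.Iio i).map ⟨Sum.inl, Sum.inl_injective⟩)) (Finset.Ioi i.succ) (by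
        rw [Finset.card_insert_of_notMem (by simp)]
        simp
        skip)
    have hr : x (Sum.inr 0) = 0 := hxS _ (by simp)
    have hl : ∀ j < i, x (Sum.inl j) = 0 := fun j hj => hxS _ (by simp [hj])
    have hpos := sum_sq_pos' hx0
    have hup : x ⬝ᵥ ((Yᵀ * Y) *ᵥ x) ≤ σ i ^ 2 * ∑ j, x j ^ 2 := by
      rw [hQ x hr, Fintype.sum_sum_type]
      simp only [Finset.univ_unique, Finset.sum_singleton, Fin.default_eq_zero, hr]
      rw [zero_pow two_ne_zero, add_zero, Finset.mul_sum]
      refine Finset.sum_le_sum fun j _ => ?_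
      rcases lt_or_ge j i with h | h
      · simp [hl j h]
      · exact mul_le_mul_of_nonneg_right (pow_le_pow_left₀ (hσ0 j) (hσmono h) 2) (sq_nonneg _)
    have hlow : μ i.succ ^ 2 * ∑ j, x j ^ 2 ≤ x ⬝ᵥ ((Yᵀ * Y) *ᵥ x) := by
      rw [← hL2, ← hL1, Finset.mul_sum]
      refine Finset.sum_le_sum fun j _ => ?_
      rcases lt_or_ge i.succ j with h | h
      · simp [hxT j (by simpa using h)]
      · exact mul_le_mul_of_nonneg_right (pow_le_pow_left₀ (hμ0 _) (hμmono h) 2) (sq_nonneg _)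
    exact (sq_le_sq₀ (by first | exact hμ0 _ | exact hσ0 _) (by first | exact hμ0 _ | exact hσ0 _)).1 (le_of_mul_le_mul_right (hlow.trans hup) hpos)
  · obtain ⟨x, hx0, hxS, hxT⟩ := exists_common_zero L
      (insert (Sum.inr 0) ((Finset.Ioi i).map ⟨Sum.inl, Sum.inl_injective⟩))
      (Finset.Iio i.castSucc) (by
        rw [Finset.card_insert_of_notMem (by simp)]
        simp
        omega)
    have hr : x (Sum.inr 0) = 0 := hxS _ (by simp)
    have hl : ∀ j, i < j → x (Sum.inl j) = 0 := fun j hj => hxS _ (by simp [hj])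
    have hpos := sum_sq_pos' hx0
    have hlow : σ i ^ 2 * ∑ j, x j ^ 2 ≤ x ⬝ᵥ ((Yᵀ * Y) *ᵥ x) := by
      rw [hQ x hr, Fintype.sum_sum_type]
      simp only [Finset.univ_unique, Finset.sum_singleton, Fin.default_eq_zero, hr]
      rw [zero_pow two_ne_zero, add_zero, Finset.mul_sum]
      refine Finset.sum_le_sum fun j _ => ?_
      rcases lt_or_ge i j with h | h
      · simp [hl j h]
      · exact mul_le_mul_of_nonneg_right (pow_le_pow_left₀ (hσ0 i) (hσmono h) 2) (sq_nonneg _)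
    have hup : x ⬝ᵥ ((Yᵀ * Y) *ᵥ x) ≤ μ i.castSucc ^ 2 * ∑ j, x j ^ 2 := by
      rw [← hL2, ← hL1, Finset.mul_sum]
      refine Finset.sum_le_sum fun j _ => ?_
      rcases lt_or_ge j i.castSucc with h | h
      · simp [hxT j (by simpa using h)]
      · exact mul_le_mul_of_nonneg_right (pow_le_pow_left₀ (hμ0 _) (hμmono h) 2) (sq_nonneg _)
    exact (sq_le_sq₀ (by first | exact hμ0 _ | exact hσ0 _) (by first | exact hμ0 _ | exact hσ0 _)).1 (le_of_mul_le_mul_right (hlow.trans hup) hpos)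
end

section
/- Let α ∈ (0,1), λ ≥ 0, Δt > 0, and t_n = nΔt. Then for every positive integer N, every real inner product space V with inner product ⟨·,·⟩, and every choice of vectors v₀, v₁, …, v_N ∈ V with v₀ = 0, the double sum Σ_{n=1}^{N} Σ_{p=0}^{n} ω_p^{(α,λ)} ⟨v_{n−p}, v_n⟩ is nonnegative. -/
open scoped RealInnerProductSpace

/-- `σ_s^{(α)} = Γ(α+s)/(Γ(α)Γ(s+1))`. -/
noncomputable def cqSigma (α : ℝ) (s : ℕ) : ℝ :=
  Real.Gamma (α + s) / (Real.Gamma α * Real.Gamma (s + 1))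

/-- `β_s^{(α)} = α(α−1)⋯(α−s+1)/s!`. -/
noncomputable def cqBeta (α : ℝ) (s : ℕ) : ℝ :=
  (∏ i ∈ Finset.range s, (α - i)) / (Nat.factorial s)

/-- Convolution-quadrature weight `ω_n^{(α,0)} = 2^{−α} Σ_{s=0}^n σ_s^{(α)} β_{n−s}^{(α)}`. -/
noncomputable def cqWeight (α : ℝ) (n : ℕ) : ℝ :=
  (2 : ℝ) ^ (-α) * ∑ s ∈ Finset.range (n + 1), cqSigma α s * cqBeta α (n - s)

/-- Tempered weight `ω_n^{(α,λ)} = e^{−λ t_n} ω_n^{(α,0)}` with `t_n = nΔt`. -/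
noncomputable def temperedWeight (α lam Δt : ℝ) (n : ℕ) : ℝ :=
  Real.exp (-(lam * (n * Δt))) * cqWeight α n

lemma hasSum_of_pointwise {E : Type*} [AddCommMonoid E] [TopologicalSpace E] {f g : ℕ → E} {a : E}
    (h : HasSum f a) (hfg : ∀ n, f n = g n) : HasSum g a := by
  rwa [← funext hfg]

lemma cqBeta_eq_choose (a : ℝ) (n : ℕ) : cqBeta a n = Ring.choose a n := by
  rw [Ring.choose_eq_smul, cqBeta]
  have : ∀ n : ℕ, (descPochhammer ℤ n).smeval a = ∏ i ∈ Finset.range n, (a - i) := by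
    intro n
    induction n with
    | zero => simp
    | succ n ih =>
      rw [Finset.prod_range_succ, ← ih, descPochhammer_succ_right, Polynomial.smeval_mul]
      simp [Polynomial.smeval_natCast]
  rw [this, smul_eq_mul]
  field_simp

lemma cqSigma_eq (a : ℝ) (ha : 0 < a) (n : ℕ) : cqSigma a n = (-1) ^ n * cqBeta (-a) n := by
  induction n with
  | zero =>
    have := (Real.Gamma_pos_of_pos ha).ne'
    simp [cqSigma, cqBeta, this]
  | succ n ih =>
    have h1 := (Real.Gamma_pos_of_pos ha).ne'
    have h2 : Real.Gamma (a + (n + 1 : ℕ)) = (a + n) * Real.Gamma (a + n) := by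
      rw [← Real.Gamma_add_one (by positivity)]
      push_cast; ring_nf
    have h3 : cqSigma a (n + 1) = (a + n) / (n + 1) * cqSigma a n := by
      unfold cqSigma
      rw [h2, Real.Gamma_nat_eq_factorial, Real.Gamma_nat_eq_factorial, Nat.factorial_succ]
      have : ((n.factorial : ℕ) : ℝ) ≠ 0 := by positivity
      push_cast
      field_simp
    have h4 : cqBeta (-a) (n + 1) = (-a - n) / (n + 1) * cqBeta (-a) n := by
      unfold cqBeta
      rw [Finset.prod_range_succ, Nat.factorial_succ]
      have : ((n.factorial : ℕ) : ℝ) ≠ 0 := by positivity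
      push_cast
      field_simp
    rw [h3, h4, ih, pow_succ]
    ring

lemma hasSum_cqBeta (a : ℝ) (z : ℂ) (hz : ‖z‖ < 1) :
    HasSum (fun n => (cqBeta a n : ℂ) * z ^ n) ((1 + z) ^ (a : ℂ)) := by
  have h := (Complex.one_add_cpow_hasFPowerSeriesOnBall_zero (a := (a : ℂ))).hasSum
    (y := z) (by simpa [← ofReal_norm, ENNReal.ofReal_lt_one] using hz)
  rw [zero_add] at h
  refine hasSum_of_pointwise h fun n => ?_
  simp [cqBeta_eq_choose, Complex.ofReal_choose, binomialSeries_apply, List.ofFn_const,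
    -FormalMultilinearSeries.apply_eq_prod_smul_coeff]

lemma hasSum_cqSigma (a : ℝ) (ha : 0 < a) (z : ℂ) (hz : ‖z‖ < 1) :
    HasSum (fun n => (cqSigma a n : ℂ) * z ^ n) ((1 - z) ^ (-(a : ℂ))) := by
  have h := hasSum_cqBeta (-a) (-z) (by simpa using hz)
  rw [← sub_eq_add_neg] at h
  push_cast at h
  convert h using 2 with n
  rw [cqSigma_eq a ha, neg_pow z]
  push_cast
  ring

lemma hasSum_cqWeight (a : ℝ) (ha : 0 < a) (z : ℂ) (hz : ‖z‖ < 1) :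
    HasSum (fun n => (cqWeight a n : ℂ) * z ^ n)
      (((2 : ℝ) ^ (-a) : ℝ) * ((1 - z) ^ (-(a : ℂ)) * (1 + z) ^ (a : ℂ))) := by
  have hs := hasSum_cqSigma a ha z hz
  have hb := hasSum_cqBeta a z hz
  have hs' := hs.summable.norm
  have hb' := hb.summable.norm
  have h1 := (summable_norm_sum_mul_range_of_summable_norm hs' hb').of_norm.hasSum
  rw [← tsum_mul_tsum_eq_tsum_sum_range_of_summable_norm hs' hb', hs.tsum_eq, hb.tsum_eq] at h1
  have h2 := h1.mul_left (((2 : ℝ) ^ (-a) : ℝ) : ℂ)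
  refine hasSum_of_pointwise h2 fun n => Eq.symm ?_
  unfold cqWeight
  push_cast
  rw [mul_assoc, Finset.sum_mul]
  congr 1
  refine Finset.sum_congr rfl fun k hk => ?_
  have : n = k + (n - k) := by have := Finset.mem_range.1 hk; omega
  conv_lhs => rw [show z ^ n = z ^ k * z ^ (n - k) by rw [← pow_add, ← this]]
  ring

lemma re_cq_nonneg (a : ℝ) (ha : 0 < a) (ha1 : a < 1) (z : ℂ) (hz : ‖z‖ < 1) :
    0 ≤ (((1 - z) ^ (-(a : ℂ)) * (1 + z) ^ (a : ℂ)) : ℂ).re := by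
  have hre : |z.re| < 1 := lt_of_le_of_lt (Complex.abs_re_le_norm z) hz
  obtain ⟨hr1, hr2⟩ := abs_lt.1 hre
  have hp : 0 < (1 + z).re := by simp; linarith
  have hm : 0 < (1 - z).re := by simp; linarith
  have hp0 : (1 + z) ≠ 0 := by intro h; rw [h] at hp; simp at hp
  have hm0 : (1 - z) ≠ 0 := by intro h; rw [h] at hm; simp at hm
  have ap := abs_lt.1 (Complex.abs_arg_lt_pi_div_two_iff.2 (Or.inl hp))
  have am := abs_lt.1 (Complex.abs_arg_lt_pi_div_two_iff.2 (Or.inl hm))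
  set w := Complex.log (1 + z) - Complex.log (1 - z) with hw
  have hwim : w.im = (1 + z).arg - (1 - z).arg := by simp [hw, Complex.log_im]
  have he : Complex.exp w = (1 + z) / (1 - z) := by
    rw [hw, Complex.exp_sub, Complex.exp_log hp0, Complex.exp_log hm0]
  have hlog : w = Complex.log ((1 + z) / (1 - z)) := by
    rw [← he, Complex.log_exp] <;> rw [hwim] <;> linarith
  have hq : 0 < ((1 + z) / (1 - z)).re := by
    rw [Complex.div_re, ← add_div]
    apply div_pos _ (Complex.normSq_pos.2 hm0)
    have : z.re ^ 2 + z.im ^ 2 < 1 := by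
      have h1 : Complex.normSq z < 1 := by
        rw [Complex.normSq_eq_norm_sq]; nlinarith [norm_nonneg z]
      rw [Complex.normSq_apply] at h1; nlinarith
    simp
    nlinarith
  have aw := abs_lt.1 (Complex.abs_arg_lt_pi_div_two_iff.2 (Or.inl hq))
  rw [← Complex.log_im, ← hlog] at aw
  have hF : ((1 - z) ^ (-(a : ℂ)) * (1 + z) ^ (a : ℂ) : ℂ) = Complex.exp (a * w) := by
    rw [Complex.cpow_def_of_ne_zero hm0, Complex.cpow_def_of_ne_zero hp0, ← Complex.exp_add, hw]
    congr 1; ring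
  rw [hF, Complex.exp_re]
  apply mul_nonneg (Real.exp_pos _).le
  simp only [Complex.mul_im, Complex.ofReal_re, Complex.ofReal_im, zero_mul, add_zero]
  apply Real.cos_nonneg_of_neg_pi_div_two_le_of_le <;> nlinarith [Real.pi_pos]

lemma integral_cos_int (k : ℤ) :
    ∫ x in (0 : ℝ)..(2 * Real.pi), Real.cos (k * x) = if k = 0 then 2 * Real.pi else 0 := by
  split_ifs with h
  · simp [h]
  · have hk : (k : ℝ) ≠ 0 := by exact_mod_cast h
    rw [intervalIntegral.integral_comp_mul_left (fun x => Real.cos x) hk, integral_cos]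
    have : Real.sin (k * (2 * Real.pi)) = 0 := by
      have := Real.sin_int_mul_pi (k * 2)
      push_cast at this
      rw [← this]; ring_nf
    simp [this]

lemma integral_cos_cos (k l : ℤ) :
    ∫ x in (0 : ℝ)..(2 * Real.pi), Real.cos (k * x) * Real.cos (l * x)
      = (if k = l then Real.pi else 0) + (if k = -l then Real.pi else 0) := by
  have h : ∀ x : ℝ, Real.cos (k * x) * Real.cos (l * x)
      = (Real.cos (((k - l : ℤ) : ℝ) * x) + Real.cos (((k + l : ℤ) : ℝ) * x)) / 2 := by
    intro x
    push_cast
    rw [sub_mul, add_mul, Real.cos_sub, Real.cos_add]; ring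
  simp_rw [h]
  rw [intervalIntegral.integral_div, intervalIntegral.integral_add
    (Continuous.intervalIntegrable (by fun_prop) _ _)
    (Continuous.intervalIntegrable (by fun_prop) _ _), integral_cos_int, integral_cos_int]
  simp only [sub_eq_zero, add_eq_zero_iff_eq_neg]
  split_ifs <;> ring

lemma integral_tsum_cos (a : ℕ → ℝ) (ha : Summable fun n => |a n|) (l : ℤ) :
    ∫ x in (0 : ℝ)..(2 * Real.pi), (∑' p, a p * Real.cos (p * x)) * Real.cos (l * x)
      = Real.pi * ((if 0 ≤ l then a l.toNat else 0) + (if l ≤ 0 then a (-l).toNat else 0)) := by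
  have h := intervalIntegral.hasSum_integral_of_dominated_convergence
    (μ := MeasureTheory.volume) (a := 0) (b := 2 * Real.pi)
    (F := fun p x => a p * Real.cos (p * x) * Real.cos (l * x))
    (f := fun x => (∑' p, a p * Real.cos (p * x)) * Real.cos (l * x))
    (fun p _ => |a p|)
    (fun p => Continuous.aestronglyMeasurable (by fun_prop))
    (fun p => Filter.Eventually.of_forall fun x _ => by
      rw [Real.norm_eq_abs, abs_mul, abs_mul, mul_assoc]
      have h1 := Real.abs_cos_le_one (p * x)
      have h2 := Real.abs_cos_le_one (l * x)
      exact mul_le_of_le_one_right (abs_nonneg _) (mul_le_one₀ h1 (abs_nonneg _) h2))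
    (Filter.Eventually.of_forall fun x _ => ha)
    (by simp)
    (Filter.Eventually.of_forall fun x _ => by
      refine (Summable.hasSum ?_).mul_right _
      refine Summable.of_norm_bounded ha fun p => ?_
      rw [Real.norm_eq_abs, abs_mul]
      exact mul_le_of_le_one_right (abs_nonneg _) (Real.abs_cos_le_one _))
  have h' : ∀ p : ℕ, ∫ x in (0 : ℝ)..(2 * Real.pi), a p * Real.cos (p * x) * Real.cos (l * x)
      = (if p = l.toNat then (if 0 ≤ l then Real.pi * a l.toNat else 0) else 0)
        + (if p = (-l).toNat then (if l ≤ 0 then Real.pi * a (-l).toNat else 0) else 0) := by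
    intro p
    have := integral_cos_cos p l
    simp only [Int.cast_natCast] at this
    simp_rw [mul_assoc]
    rw [intervalIntegral.integral_const_mul, this, mul_add]
    congr 1
    · by_cases hp : (p : ℤ) = l
      · have h1 : p = l.toNat := by omega
        have h2 : 0 ≤ l := by omega
        rw [if_pos hp, if_pos h1, if_pos h2, ← h1]; ring
      · rw [if_neg hp]
        split_ifs <;> first | omega | simp
    · by_cases hp : (p : ℤ) = -l
      · have h1 : p = (-l).toNat := by omega
        have h2 : l ≤ 0 := by omega
        rw [if_pos hp, if_pos h1, if_pos h2, ← h1]; ring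
      · rw [if_neg hp]
        split_ifs <;> first | omega | simp
  simp_rw [h'] at h
  have h2 := (hasSum_ite_eq l.toNat (if 0 ≤ l then Real.pi * a l.toNat else 0)).add
    (hasSum_ite_eq (-l).toNat (if l ≤ 0 then Real.pi * a (-l).toNat else 0))
  rw [h.unique h2, mul_add]
  simp

lemma toeplitz_nonneg (a : ℕ → ℝ) (ha : Summable fun n => |a n|)
    (hpos : ∀ x : ℝ, 0 ≤ ∑' p, a p * Real.cos (p * x))
    {V : Type*} [NormedAddCommGroup V] [InnerProductSpace ℝ V] (v : ℕ → V) (N : ℕ) :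
    0 ≤ ∑ n ∈ Finset.range N, ∑ p ∈ Finset.range (n + 1), a p * ⟪v (n - p), v n⟫ := by
  have hcont : Continuous fun x : ℝ => ∑' p, a p * Real.cos (p * x) := by
    refine continuous_tsum (fun p => by fun_prop) ha fun p x => ?_
    rw [Real.norm_eq_abs, abs_mul]
    exact mul_le_of_le_one_right (abs_nonneg _) (Real.abs_cos_le_one _)
  have key : ∀ x : ℝ, ∑ n ∈ Finset.range N, ∑ m ∈ Finset.range N,
      ⟪v m, v n⟫ * ((∑' p, a p * Real.cos (p * x)) * Real.cos (((n - m : ℤ) : ℝ) * x))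
      = (∑' p, a p * Real.cos (p * x)) *
        (‖∑ n ∈ Finset.range N, Real.cos (n * x) • v n‖ ^ 2
          + ‖∑ n ∈ Finset.range N, Real.sin (n * x) • v n‖ ^ 2) := by
    intro x
    rw [← real_inner_self_eq_norm_sq, ← real_inner_self_eq_norm_sq]
    simp only [sum_inner, inner_sum, real_inner_smul_left, real_inner_smul_right]
    rw [← Finset.sum_add_distrib, Finset.mul_sum]
    refine Finset.sum_congr rfl fun n _ => ?_
    rw [← Finset.sum_add_distrib, Finset.mul_sum]
    refine Finset.sum_congr rfl fun m _ => ?_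
    push_cast
    rw [sub_mul, Real.cos_sub, real_inner_comm]
    ring
  have hint : 0 ≤ ∫ x in (0 : ℝ)..(2 * Real.pi), ∑ n ∈ Finset.range N, ∑ m ∈ Finset.range N,
      ⟪v m, v n⟫ * ((∑' p, a p * Real.cos (p * x)) * Real.cos (((n - m : ℤ) : ℝ) * x)) := by
    refine intervalIntegral.integral_nonneg (by positivity) fun x _ => ?_
    rw [key]
    exact mul_nonneg (hpos x) (by positivity)
  rw [intervalIntegral.integral_finsetSum
    (fun n _ => Continuous.intervalIntegrable (by fun_prop) _ _)] at hint
  have hswap : ∀ n ∈ Finset.range N, ∫ x in (0 : ℝ)..(2 * Real.pi), ∑ m ∈ Finset.range N,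
      ⟪v m, v n⟫ * ((∑' p, a p * Real.cos (p * x)) * Real.cos (((n - m : ℤ) : ℝ) * x))
      = ∑ m ∈ Finset.range N, ⟪v m, v n⟫ * (Real.pi *
      ((if (0 : ℤ) ≤ n - m then a ((n : ℤ) - m).toNat else 0)
        + (if (n - m : ℤ) ≤ 0 then a (-((n : ℤ) - m)).toNat else 0))) := by
    intro n _
    rw [intervalIntegral.integral_finsetSum
      (fun m _ => Continuous.intervalIntegrable (by fun_prop) _ _)]
    refine Finset.sum_congr rfl fun m _ => ?_
    rw [intervalIntegral.integral_const_mul, integral_tsum_cos a ha]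
  rw [Finset.sum_congr rfl hswap] at hint
  have hlow : ∀ n ∈ Finset.range N, ∑ m ∈ Finset.range N,
      ⟪v m, v n⟫ * (if (0 : ℤ) ≤ n - m then a ((n : ℤ) - m).toNat else 0)
      = ∑ p ∈ Finset.range (n + 1), a p * ⟪v (n - p), v n⟫ := by
    intro n hn
    have hn := Finset.mem_range.1 hn
    rw [← Finset.sum_range_reflect (fun p => a p * ⟪v (n - p), v n⟫) (n + 1)]
    rw [← Finset.sum_subset (Finset.range_subset_range.2 (show n + 1 ≤ N by omega))]
    · refine Finset.sum_congr rfl fun m hm => ?_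
      have hm := Finset.mem_range.1 hm
      rw [if_pos (by omega), show ((n : ℤ) - m).toNat = n + 1 - 1 - m by omega,
        show n - (n + 1 - 1 - m) = m by omega]
      ring
    · intro m _ hm
      rw [Finset.mem_range] at hm
      rw [if_neg (by omega), mul_zero]
  have hup : ∑ n ∈ Finset.range N, ∑ m ∈ Finset.range N,
      ⟪v m, v n⟫ * (if (n - m : ℤ) ≤ 0 then a (-((n : ℤ) - m)).toNat else 0)
      = ∑ n ∈ Finset.range N, ∑ m ∈ Finset.range N,
      ⟪v m, v n⟫ * (if (0 : ℤ) ≤ n - m then a ((n : ℤ) - m).toNat else 0) := by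
    rw [Finset.sum_comm]
    refine Finset.sum_congr rfl fun n _ => Finset.sum_congr rfl fun m _ => ?_
    rw [real_inner_comm, neg_sub]
    congr 1
    exact if_congr (by omega) rfl rfl
  have htot : ∑ n ∈ Finset.range N, ∑ m ∈ Finset.range N, ⟪v m, v n⟫ * (Real.pi *
      ((if (0 : ℤ) ≤ n - m then a ((n : ℤ) - m).toNat else 0)
        + (if (n - m : ℤ) ≤ 0 then a (-((n : ℤ) - m)).toNat else 0)))
      = Real.pi * (2 * ∑ n ∈ Finset.range N, ∑ p ∈ Finset.range (n + 1),
          a p * ⟪v (n - p), v n⟫) := by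
    rw [← Finset.sum_congr rfl hlow, two_mul]
    nth_rewrite 2 [← hup]
    rw [← Finset.sum_add_distrib, Finset.mul_sum]
    refine Finset.sum_congr rfl fun n _ => ?_
    rw [← Finset.sum_add_distrib, Finset.mul_sum]
    refine Finset.sum_congr rfl fun m _ => ?_
    ring
  rw [htot] at hint
  have := nonneg_of_mul_nonneg_right hint Real.pi_pos
  linarith

lemma cqWeight_scaled_nonneg (α : ℝ) (hα : α ∈ Set.Ioo (0 : ℝ) 1) (r : ℝ) (hr : r ∈ Set.Ico (0 : ℝ) 1)
    {V : Type*} [NormedAddCommGroup V] [InnerProductSpace ℝ V] (v : ℕ → V) (N : ℕ) :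
    0 ≤ ∑ n ∈ Finset.range N, ∑ p ∈ Finset.range (n + 1),
      (cqWeight α p * r ^ p) * ⟪v (n - p), v n⟫ := by
  apply toeplitz_nonneg (fun p => cqWeight α p * r ^ p)
  · have h := (hasSum_cqWeight α hα.1 (r : ℂ)
      (by simpa [abs_of_nonneg hr.1] using hr.2)).summable.norm
    refine h.congr fun n => ?_
    rw [← Complex.ofReal_pow, ← Complex.ofReal_mul, Complex.norm_real, Real.norm_eq_abs]
  · intro x
    have hz : ‖(r : ℂ) * Complex.exp (x * Complex.I)‖ < 1 := by
      rw [norm_mul, Complex.norm_exp_ofReal_mul_I]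
      simpa [abs_of_nonneg hr.1] using hr.2
    have h := Complex.hasSum_re (hasSum_cqWeight α hα.1 _ hz)
    have h' := hasSum_of_pointwise (g := fun p : ℕ => cqWeight α p * r ^ p * Real.cos (p * x)) h
      (fun p => by
        rw [mul_pow, ← Complex.exp_nat_mul, ← mul_assoc, ← Complex.ofReal_pow,
          ← Complex.ofReal_mul, Complex.re_ofReal_mul,
          show (p : ℂ) * (x * Complex.I) = ((p * x : ℝ) : ℂ) * Complex.I by push_cast; ring,
          Complex.exp_ofReal_mul_I_re])
    rw [h'.tsum_eq, Complex.re_ofReal_mul]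
    exact mul_nonneg (by positivity) (re_cq_nonneg α hα.1 hα.2 _ hz)

/-- positive definiteness of the tempered convolution-quadrature
weights: for any real inner product space `V` and vectors `v₀ = 0, v₁, …, v_N`,
`Σ_{n=1}^N Σ_{p=0}^n ω_p^{(α,λ)} ⟨v_{n−p}, v_n⟩ ≥ 0`. -/
theorem tempered_weights_positive_definite
    (α lam Δt : ℝ) (hα : α ∈ Set.Ioo (0 : ℝ) 1) (hlam : 0 ≤ lam) (hΔt : 0 < Δt)
    (N : ℕ) (hN : 1 ≤ N)
    (V : Type*) [NormedAddCommGroup V] [InnerProductSpace ℝ V]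
    (v : ℕ → V) (hv0 : v 0 = 0) :
    0 ≤ ∑ n ∈ Finset.Icc 1 N, ∑ p ∈ Finset.range (n + 1),
        temperedWeight α lam Δt p * ⟪v (n - p), v n⟫ := by
  have hclosed : ∀ r ∈ Set.Icc (0 : ℝ) 1, 0 ≤ ∑ n ∈ Finset.range (N + 1),
      ∑ p ∈ Finset.range (n + 1), (cqWeight α p * r ^ p) * ⟪v (n - p), v n⟫ := by
    have hcl : IsClosed {r : ℝ | 0 ≤ ∑ n ∈ Finset.range (N + 1),
        ∑ p ∈ Finset.range (n + 1), (cqWeight α p * r ^ p) * ⟪v (n - p), v n⟫} :=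
      isClosed_le continuous_const (by fun_prop)
    have hsub := hcl.closure_subset_iff.2
      (fun r hr => cqWeight_scaled_nonneg α hα r hr v (N + 1))
    rw [closure_Ico (by norm_num)] at hsub
    exact fun r hr => hsub hr
  have h := hclosed (Real.exp (-(lam * Δt)))
    ⟨(Real.exp_pos _).le, Real.exp_le_one_iff.2 (by have := mul_nonneg hlam hΔt.le; linarith)⟩
  rw [Finset.range_eq_Ico, Finset.sum_eq_sum_Ico_succ_bot (by omega)] at h
  simp only [hv0, inner_zero_right, mul_zero, Finset.sum_const_zero, zero_add] at h
  convert h using 1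
  refine Finset.sum_congr (by ext; simp) fun n _ => Finset.sum_congr rfl fun p _ => ?_
  rw [temperedWeight, ← Real.exp_nat_mul]
  ring_nf
end

section
/- Let α ∈ (0,1). There exists a constant C > 0, depending only on α, such that |ω_n^{(α,0)}| ≤ C·n^{α−1} for every integer n ≥ 1. Consequently, for every λ ≥ 0 and Δt > 0 the tempered weights satisfy |ω_n^{(α,λ)}| ≤ C·n^{α−1} for all n ≥ 1. -/
lemma cqSigma_succ (α : ℝ) (hα : 0 < α) (n : ℕ) :
    ((n : ℝ) + 1) * cqSigma α (n + 1) = (α + n) * cqSigma α n := by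
  unfold cqSigma
  have h1 : Real.Gamma α ≠ 0 := (Real.Gamma_pos_of_pos hα).ne'
  have hn : (0 : ℝ) < (n : ℝ) + 1 := by positivity
  have h2 : Real.Gamma ((n : ℝ) + 1) ≠ 0 := (Real.Gamma_pos_of_pos hn).ne'
  have h3 : Real.Gamma (α + ((n + 1 : ℕ) : ℝ)) = (α + n) * Real.Gamma (α + n) := by
    rw [← Real.Gamma_add_one (by positivity)]
    congr 1
    push_cast
    ring
  have h4 : Real.Gamma (((n + 1 : ℕ) : ℝ) + 1) = ((n : ℝ) + 1) * Real.Gamma ((n : ℝ) + 1) := by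
    rw [← Real.Gamma_add_one hn.ne']
    push_cast
    rfl
  rw [h3, h4]
  field_simp

lemma cqBeta_succ (α : ℝ) (n : ℕ) :
    ((n : ℝ) + 1) * cqBeta α (n + 1) = (α - n) * cqBeta α n := by
  unfold cqBeta
  rw [Finset.prod_range_succ, Nat.factorial_succ]
  have h : (Nat.factorial n : ℝ) ≠ 0 := by positivity
  have hn : (n : ℝ) + 1 ≠ 0 := by positivity
  push_cast
  field_simp

/-- The power series whose coefficients are the unnormalised weights. -/
noncomputable def cqSeries (α : ℝ) : PowerSeries ℝ :=
  PowerSeries.mk (cqSigma α) * PowerSeries.mk (cqBeta α)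

lemma coeff_cqSeries (α : ℝ) (n : ℕ) :
    PowerSeries.coeff n (cqSeries α) =
      ∑ s ∈ Finset.range (n + 1), cqSigma α s * cqBeta α (n - s) := by
  unfold cqSeries
  rw [PowerSeries.coeff_mul, Finset.Nat.sum_antidiagonal_eq_sum_range_succ_mk]
  simp

lemma cqSeries_ode (α : ℝ) (hα : 0 < α) :
    PowerSeries.derivative ℝ (cqSeries α) -
      PowerSeries.X * (PowerSeries.X * PowerSeries.derivative ℝ (cqSeries α)) =
      PowerSeries.C (2 * α) * cqSeries α := by
  have hS : PowerSeries.derivative ℝ (PowerSeries.mk (cqSigma α)) -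
      PowerSeries.X * PowerSeries.derivative ℝ (PowerSeries.mk (cqSigma α)) =
      PowerSeries.C α * PowerSeries.mk (cqSigma α) := by
    ext n
    have h := cqSigma_succ α hα n
    cases n with
    | zero =>
      rw [PowerSeries.coeff_C_mul, map_sub, PowerSeries.coeff_zero_X_mul,
        PowerSeries.coeff_derivative, PowerSeries.coeff_mk, PowerSeries.coeff_mk]
      simp at h ⊢
      linarith
    | succ n =>
      simp [PowerSeries.coeff_derivative, PowerSeries.coeff_succ_X_mul] at h ⊢
      linarith
  have hB : PowerSeries.derivative ℝ (PowerSeries.mk (cqBeta α)) +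
      PowerSeries.X * PowerSeries.derivative ℝ (PowerSeries.mk (cqBeta α)) =
      PowerSeries.C α * PowerSeries.mk (cqBeta α) := by
    ext n
    have h := cqBeta_succ α n
    cases n with
    | zero =>
      rw [PowerSeries.coeff_C_mul, map_add, PowerSeries.coeff_zero_X_mul,
        PowerSeries.coeff_derivative, PowerSeries.coeff_mk, PowerSeries.coeff_mk]
      simp at h ⊢
      linarith
    | succ n =>
      simp [PowerSeries.coeff_derivative, PowerSeries.coeff_succ_X_mul] at h ⊢
      linarith
  have h2 : (PowerSeries.C (2 * α) : PowerSeries ℝ) = 2 * PowerSeries.C α := by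
    rw [two_mul, map_add, two_mul]
  unfold cqSeries
  rw [Derivation.leibniz, h2]
  simp only [smul_eq_mul]
  linear_combination (PowerSeries.mk (cqBeta α)) * (1 + PowerSeries.X) * hS +
    (PowerSeries.mk (cqSigma α)) * (1 - PowerSeries.X) * hB

lemma coeff_rec (α : ℝ) (hα : 0 < α) (n : ℕ) :
    ((n : ℝ) + 3) * PowerSeries.coeff (n + 3) (cqSeries α) =
      2 * α * PowerSeries.coeff (n + 2) (cqSeries α) +
        ((n : ℝ) + 1) * PowerSeries.coeff (n + 1) (cqSeries α) := by
  have h := congrArg (PowerSeries.coeff (n + 2)) (cqSeries_ode α hα)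
  rw [map_sub, PowerSeries.coeff_succ_X_mul, PowerSeries.coeff_succ_X_mul,
    PowerSeries.coeff_derivative, PowerSeries.coeff_derivative, PowerSeries.coeff_C_mul] at h
  push_cast at h
  linarith

lemma coeff_two (α : ℝ) (hα : 0 < α) :
    PowerSeries.coeff 2 (cqSeries α) = α * PowerSeries.coeff 1 (cqSeries α) := by
  have h := congrArg (PowerSeries.coeff (0 + 1)) (cqSeries_ode α hα)
  rw [map_sub, PowerSeries.coeff_succ_X_mul, PowerSeries.coeff_zero_X_mul,
    PowerSeries.coeff_derivative, PowerSeries.coeff_C_mul] at h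
  norm_num at h
  linarith

lemma coeff_one (α : ℝ) (hα : 0 < α) :
    PowerSeries.coeff 1 (cqSeries α) = 2 * α := by
  have h := congrArg (PowerSeries.coeff 0) (cqSeries_ode α hα)
  have h0 : PowerSeries.coeff 0 (cqSeries α) = 1 := by
    have := (Real.Gamma_pos_of_pos hα).ne'
    rw [coeff_cqSeries]
    simp [cqSigma, cqBeta, this]
  rw [map_sub, PowerSeries.coeff_zero_X_mul,
    PowerSeries.coeff_derivative, PowerSeries.coeff_C_mul, h0] at h
  norm_num at h
  linarith

lemma key_ineq (α : ℝ) (h0 : 0 < α) (h1 : α < 1) (t : ℝ) (ht0 : 0 ≤ t) (ht1 : t ≤ 1) :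
    2 * α * t + (1 - t) ^ α ≤ (1 + t) ^ α := by
  have hm : MonotoneOn (fun t : ℝ => (1 + t) ^ α - (1 - t) ^ α - 2 * α * t) (Set.Icc 0 1) := by
    have hd : ∀ x ∈ Set.Ioo (0:ℝ) 1,
        HasDerivAt (fun t : ℝ => (1 + t) ^ α - (1 - t) ^ α - 2 * α * t)
          (α * ((1 + x) ^ (α - 1) + (1 - x) ^ (α - 1) - 2)) x := by
      intro x hx
      have e1 : HasDerivAt (fun t : ℝ => (1 + t)) 1 x := by
        simpa using (hasDerivAt_id x).const_add 1
      have e2 : HasDerivAt (fun t : ℝ => (1 - t)) (-1) x := by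
        simpa using (hasDerivAt_id x).const_sub 1
      have d1 := e1.rpow_const (p := α) (Or.inl (by linarith [hx.1]))
      have d2 := e2.rpow_const (p := α) (Or.inl (by linarith [hx.2]))
      have d3 := (hasDerivAt_id x).const_mul (2 * α)
      exact ((d1.sub d2).sub d3).congr_deriv (by ring)
    apply monotoneOn_of_deriv_nonneg (convex_Icc 0 1)
    · have hc : Continuous (fun t : ℝ => (1 + t) ^ α - (1 - t) ^ α - 2 * α * t) := by
        refine Continuous.sub (Continuous.sub ?_ ?_) (by fun_prop)
        · exact (continuous_const.add continuous_id).rpow_const (fun _ => Or.inr h0.le)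
        · exact (continuous_const.sub continuous_id).rpow_const (fun _ => Or.inr h0.le)
      exact hc.continuousOn
    · intro x hx
      rw [interior_Icc] at hx
      exact (hd x hx).differentiableAt.differentiableWithinAt
    · intro x hx
      rw [interior_Icc] at hx
      rw [(hd x hx).deriv]
      apply mul_nonneg h0.le
      have p1 : 0 < 1 + x := by linarith [hx.1]
      have p2 : 0 < 1 - x := by linarith [hx.2]
      have q1 : 0 < (1 + x) ^ (α - 1) := Real.rpow_pos_of_pos p1 _
      have q2 : 0 < (1 - x) ^ (α - 1) := Real.rpow_pos_of_pos p2 _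
      have hp : 1 ≤ (1 + x) ^ (α - 1) * (1 - x) ^ (α - 1) := by
        rw [← Real.mul_rpow p1.le p2.le]
        apply Real.one_le_rpow_of_pos_of_le_one_of_nonpos (by positivity)
        · nlinarith [sq_nonneg x]
        · linarith
      nlinarith [sq_nonneg ((1 + x) ^ (α - 1) - (1 - x) ^ (α - 1))]
  have := hm (Set.mem_Icc.2 ⟨le_refl 0, zero_le_one⟩) (Set.mem_Icc.2 ⟨ht0, ht1⟩) ht0
  simp at this
  linarith

lemma key_nat (α : ℝ) (h0 : 0 < α) (h1 : α < 1) (x : ℝ) (hx : 1 ≤ x) :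
    2 * α * x ^ (α - 1) + (x - 1) ^ α ≤ (x + 1) ^ α := by
  have hx0 : 0 < x := by linarith
  have hinv : x⁻¹ ≤ 1 := inv_le_one_of_one_le₀ hx
  have h := key_ineq α h0 h1 x⁻¹ (by positivity) hinv
  have h2 := mul_le_mul_of_nonneg_left h (Real.rpow_nonneg hx0.le α)
  rw [mul_add, ← Real.mul_rpow hx0.le (by linarith), ← Real.mul_rpow hx0.le (by positivity)] at h2
  have e1 : x * (1 - x⁻¹) = x - 1 := by field_simp
  have e2 : x * (1 + x⁻¹) = x + 1 := by field_simp
  have e3 : x ^ (α - 1) = x ^ α * x⁻¹ := by rw [Real.rpow_sub_one hx0.ne', div_eq_mul_inv]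
  rw [e1, e2] at h2
  rw [e3]
  linarith

lemma mul_rpow_pred (α : ℝ) {x : ℝ} (hx : 0 < x) : x * x ^ (α - 1) = x ^ α := by
  rw [Real.rpow_sub_one hx.ne']
  field_simp

lemma coeff_bound (α : ℝ) (h0 : 0 < α) (h1 : α < 1) (n : ℕ) :
    (0 ≤ PowerSeries.coeff (n + 1) (cqSeries α) ∧
      PowerSeries.coeff (n + 1) (cqSeries α) ≤ 2 * α * ((n : ℝ) + 1) ^ (α - 1)) ∧
    (0 ≤ PowerSeries.coeff (n + 2) (cqSeries α) ∧
      PowerSeries.coeff (n + 2) (cqSeries α) ≤ 2 * α * ((n : ℝ) + 2) ^ (α - 1)) := by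
  induction n with
  | zero =>
    have e2 := coeff_two α h0
    rw [coeff_one α h0] at e2
    simp only [zero_add]
    rw [e2, coeff_one α h0]
    have hk := key_nat α h0 h1 1 le_rfl
    norm_num [Real.zero_rpow h0.ne'] at hk
    have := mul_rpow_pred α (x := 2) (by norm_num)
    refine ⟨⟨by positivity, by simp⟩, by positivity, ?_⟩
    norm_num
    nlinarith
  | succ n ih =>
    obtain ⟨⟨a1, a2⟩, b1, b2⟩ := ih
    have hr := coeff_rec α h0 n
    have hn : (0 : ℝ) ≤ n := Nat.cast_nonneg n
    have hk := key_nat α h0 h1 ((n : ℝ) + 2) (by linarith)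
    have e1 : (n : ℝ) + 2 - 1 = n + 1 := by ring
    have e2 : (n : ℝ) + 2 + 1 = n + 3 := by ring
    rw [e1, e2, ← mul_rpow_pred α (x := (n : ℝ) + 1) (by linarith),
      ← mul_rpow_pred α (x := (n : ℝ) + 3) (by linarith)] at hk
    have c1 : ((n + 1 : ℕ) : ℝ) + 1 = n + 2 := by push_cast; ring
    have c2 : ((n + 1 : ℕ) : ℝ) + 2 = n + 3 := by push_cast; ring
    rw [c1, c2]
    have p3 : (0 : ℝ) < (n : ℝ) + 3 := by linarith
    refine ⟨⟨b1, b2⟩, ?_, ?_⟩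
    · have : 0 ≤ ((n : ℝ) + 3) * PowerSeries.coeff (n + 3) (cqSeries α) := by
        rw [hr]; positivity
      exact nonneg_of_mul_nonneg_right this p3
    · refine le_of_mul_le_mul_left (a := (n : ℝ) + 3) ?_ p3
      change ((n : ℝ) + 3) * PowerSeries.coeff (n + 3) (cqSeries α) ≤ _
      rw [hr]
      have m1 := mul_le_mul_of_nonneg_left b2 (by positivity : 0 ≤ 2 * α)
      have m2 := mul_le_mul_of_nonneg_left a2 (by positivity : 0 ≤ (n : ℝ) + 1)
      have m3 := mul_le_mul_of_nonneg_left hk (by positivity : 0 ≤ 2 * α)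
      linarith

/-- there is a constant `C > 0` depending only on `α` with
`|ω_n^{(α,0)}| ≤ C n^{α−1}` for all `n ≥ 1`; consequently the tempered weights
satisfy the same bound for every `λ ≥ 0` and `Δt > 0`. -/
theorem cqWeight_decay
    (α : ℝ) (hα : α ∈ Set.Ioo (0 : ℝ) 1) :
    ∃ C > 0,
      (∀ n : ℕ, 1 ≤ n → |cqWeight α n| ≤ C * (n : ℝ) ^ (α - 1)) ∧
      ∀ lam Δt : ℝ, 0 ≤ lam → 0 < Δt → ∀ n : ℕ, 1 ≤ n →
        |temperedWeight α lam Δt n| ≤ C * (n : ℝ) ^ (α - 1) := by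
  obtain ⟨h0, h1⟩ := hα
  have main : ∀ n : ℕ, 1 ≤ n →
      |cqWeight α n| ≤ (2 : ℝ) ^ (-α) * (2 * α) * (n : ℝ) ^ (α - 1) := by
    intro n hn
    obtain ⟨m, rfl⟩ := Nat.exists_eq_add_of_le' hn
    obtain ⟨⟨a1, a2⟩, -⟩ := coeff_bound α h0 h1 m
    have h2 : (0 : ℝ) < (2 : ℝ) ^ (-α) := by positivity
    unfold cqWeight
    rw [← coeff_cqSeries, abs_of_nonneg (by positivity)]
    push_cast
    rw [mul_assoc]
    exact mul_le_mul_of_nonneg_left a2 h2.le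
  refine ⟨(2 : ℝ) ^ (-α) * (2 * α), by positivity, main, ?_⟩
  intro lam Δt hl ht n hn
  refine le_trans ?_ (main n hn)
  unfold temperedWeight
  rw [abs_mul, abs_of_pos (Real.exp_pos _)]
  refine mul_le_of_le_one_left (abs_nonneg _) ?_
  rw [Real.exp_le_one_iff]
  have : 0 ≤ lam * (n * Δt) := by positivity
  linarith
end

section
/- Under the hypotheses described in the context, there exists a constant C > 0, depending only on κ and on the product c₀K₀ (in particular independent of Δt, N, the data u₀, f₁, …, f_N, and the solution), such that any solution u₁, …, u_N of the Crank–Nicolson scheme satisfies max_{1 ≤ n ≤ N} ‖u_n‖² ≤ C·( Δt·Σ_{n=1}^{N} ‖f_n‖² + ‖u₀‖² ). -/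
open scoped RealInnerProductSpace

lemma cn_double_sum (k b : ℕ → ℝ) (M : ℕ) :
    ∑ n ∈ Finset.range M, ∑ j ∈ Finset.range (n + 1), k (n - j) * (b j + b n)
      = ∑ n ∈ Finset.range M, b n *
        (∑ i ∈ Finset.range (n + 1), k i + ∑ i ∈ Finset.range (M - n), k i) := by
  induction M with
  | zero => simp
  | succ M ih =>
    rw [Finset.sum_range_succ, ih]
    have h1 : ∑ j ∈ Finset.range (M + 1), k (M - j) * (b j + b M)
        = ∑ j ∈ Finset.range (M + 1), k (M - j) * b j
          + b M * ∑ i ∈ Finset.range (M + 1), k i := by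
      rw [← Finset.sum_range_reflect k (M + 1), Finset.mul_sum, ← Finset.sum_add_distrib]
      refine Finset.sum_congr rfl fun j _ => ?_
      simp only [Nat.add_sub_cancel]
      ring
    rw [h1, Finset.sum_range_succ, Finset.sum_range_succ (fun n => b n * _)]
    have h2 : ∑ n ∈ Finset.range M, b n *
        (∑ i ∈ Finset.range (n + 1), k i + ∑ i ∈ Finset.range (M + 1 - n), k i)
        = ∑ n ∈ Finset.range M, b n *
        (∑ i ∈ Finset.range (n + 1), k i + ∑ i ∈ Finset.range (M - n), k i)
        + ∑ n ∈ Finset.range M, k (M - n) * b n := by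
      rw [← Finset.sum_add_distrib]
      refine Finset.sum_congr rfl fun n hn => ?_
      have : M + 1 - n = (M - n) + 1 := by
        have := Finset.mem_range.mp hn
        omega
      rw [this, Finset.sum_range_succ k (M - n)]
      ring
    rw [h2]
    simp
    ring

lemma cn_real (κ q c₀ K₀ dt : ℝ) (N : ℕ) (k x a φ : ℕ → ℝ) (hq1 : q < 1)
    (hc : 0 < c₀) (hdt : 0 < dt)
    (hS : ∀ n : ℕ, 1 ≤ n → n ≤ N → dt * ∑ m ∈ Finset.range n, k m ≤ K₀)
    (hq : c₀ * K₀ = q)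
    (hstep : ∀ n < N, x (n + 1) - x n + 2 * dt * a n ^ 2 ≤
      dt * (c₀ * dt * ∑ j ∈ Finset.range (n + 1), k (n - j) * (a j ^ 2 + a n ^ 2))
        + 2 * dt * (κ * φ n * a n))
    (M : ℕ) (hM : M ≤ N) :
    x M ≤ x 0 + κ ^ 2 / (2 * (1 - q)) * (dt * ∑ n ∈ Finset.range M, φ n ^ 2) := by
  have h1 : ∑ n ∈ Finset.range M, (x (n + 1) - x n + 2 * dt * a n ^ 2) ≤
      ∑ n ∈ Finset.range M,
      (dt * (c₀ * dt * ∑ j ∈ Finset.range (n + 1), k (n - j) * (a j ^ 2 + a n ^ 2))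
        + 2 * dt * (κ * φ n * a n)) :=
    Finset.sum_le_sum fun n hn => hstep n (by have := Finset.mem_range.mp hn; omega)
  rw [Finset.sum_add_distrib, Finset.sum_add_distrib, Finset.sum_range_sub, ← Finset.mul_sum,
    ← Finset.mul_sum, ← Finset.mul_sum, ← Finset.mul_sum,
    cn_double_sum k (fun n => a n ^ 2)] at h1
  have h2 : dt * ∑ n ∈ Finset.range M, a n ^ 2 *
        (∑ i ∈ Finset.range (n + 1), k i + ∑ i ∈ Finset.range (M - n), k i)
        ≤ 2 * K₀ * ∑ n ∈ Finset.range M, a n ^ 2 := by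
    rw [Finset.mul_sum, Finset.mul_sum]
    refine Finset.sum_le_sum fun n hn => ?_
    have hn := Finset.mem_range.mp hn
    have e1 := hS (n + 1) (by omega) (by omega)
    have e2 := hS (M - n) (by omega) (by omega)
    nlinarith [mul_le_mul_of_nonneg_left (add_le_add e1 e2) (sq_nonneg (a n))]
  have h3 : ∑ n ∈ Finset.range M, κ * φ n * a n ≤
      (1 - q) * ∑ n ∈ Finset.range M, a n ^ 2
        + κ ^ 2 / (4 * (1 - q)) * ∑ n ∈ Finset.range M, φ n ^ 2 := by
    rw [Finset.mul_sum, Finset.mul_sum, ← Finset.sum_add_distrib]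
    refine Finset.sum_le_sum fun n _ => ?_
    have hp : 0 < 1 - q := by linarith
    have : (1 - q) * a n ^ 2 + κ ^ 2 / (4 * (1 - q)) * φ n ^ 2 - κ * φ n * a n
        = (1 - q) * (a n - κ * φ n / (2 * (1 - q))) ^ 2 := by
      field_simp
      ring
    have := mul_nonneg hp.le (sq_nonneg (a n - κ * φ n / (2 * (1 - q))))
    linarith
  have h4 := mul_le_mul_of_nonneg_left h2 (mul_pos hdt hc).le
  have h5 := mul_le_mul_of_nonneg_left h3 (mul_pos two_pos hdt).le
  have h6 : κ ^ 2 / (2 * (1 - q)) = 2 * (κ ^ 2 / (4 * (1 - q))) := by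
    have hp : 1 - q ≠ 0 := by linarith
    field_simp
    norm_num
  rw [h6]
  subst hq
  linarith

/-- unconditional stability of the Crank–Nicolson scheme for the
abstract Oldroyd problem. There is a constant `C > 0` depending only on `κ` and
on the product `q = c₀K₀ < 1` such that any solution of the scheme satisfies
`max_{1≤n≤N} ‖u_n‖² ≤ C (Δt Σ_{n=1}^N ‖f_n‖² + ‖u₀‖²)`, where `Δt = T/N` and
`ū_j = (u_j + u_{j−1})/2`. -/
theorem crank_nicolson_stability
    (κ q : ℝ) (hκ : 0 < κ) (hq0 : 0 ≤ q) (hq1 : q < 1) :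
    ∃ C > 0, ∀ (V : Type) [inst1 : NormedAddCommGroup V] [inst2 : InnerProductSpace ℝ V],
      ∀ (A B : V →ₗ[ℝ] V →ₗ[ℝ] ℝ) (Ct : V →ₗ[ℝ] V →ₗ[ℝ] V →ₗ[ℝ] ℝ)
        (c₀ K₀ T dt : ℝ) (N : ℕ) (K : ℝ → ℝ) (u f : ℕ → V),
        -- `𝒜` symmetric positive semidefinite, with `‖v‖ ≤ κ‖v‖_a`
        (∀ v w : V, A v w = A w v) →
        (∀ v : V, 0 ≤ A v v) →
        (∀ v : V, ‖v‖ ≤ κ * Real.sqrt (A v v)) →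
        -- `ℬ` bounded by `c₀` in the `‖·‖_a` norm
        0 < c₀ →
        (∀ v w : V, |B v w| ≤ c₀ * Real.sqrt (A v v) * Real.sqrt (A w w)) →
        -- `𝒞` trilinear with `𝒞(u,v,v) = 0`
        (∀ v w : V, Ct v w w = 0) →
        -- time grid
        0 < T → 1 ≤ N → dt = T / N →
        -- kernel: nonnegative, quadrature bound `K₀`, smallness `c₀K₀ = q < 1`
        (∀ t ∈ Set.Icc (0 : ℝ) T, 0 ≤ K t) →
        0 ≤ K₀ →
        (∀ n : ℕ, 1 ≤ n → n ≤ N → dt * ∑ m ∈ Finset.range n, K ((m : ℝ) * dt) ≤ K₀) →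
        c₀ * K₀ = q →
        -- the Crank–Nicolson scheme
        (∀ n : ℕ, 1 ≤ n → n ≤ N → ∀ v : V,
          ⟪dt⁻¹ • (u n - u (n - 1)), v⟫
            + A ((1 / 2 : ℝ) • (u n + u (n - 1))) v
            + B (dt • (∑ j ∈ Finset.Icc 1 (n - 1),
                  K (((n : ℝ) - (j : ℝ)) * dt) • ((1 / 2 : ℝ) • (u j + u (j - 1))))
                + (dt / 2 * K 0) • ((1 / 2 : ℝ) • (u n + u (n - 1)))) v
            + Ct ((1 / 2 : ℝ) • (u n + u (n - 1))) ((1 / 2 : ℝ) • (u n + u (n - 1))) v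
          = ⟪f n, v⟫) →
        -- stability estimate
        ∀ n : ℕ, 1 ≤ n → n ≤ N →
          ‖u n‖ ^ 2 ≤ C * (dt * ∑ m ∈ Finset.Icc 1 N, ‖f m‖ ^ 2 + ‖u 0‖ ^ 2) := by
  have hp : 0 < 1 - q := by linarith
  have hC : 0 ≤ κ ^ 2 / (2 * (1 - q)) := by positivity
  refine ⟨1 + κ ^ 2 / (2 * (1 - q)), by positivity, ?_⟩
  intro V _ _ A B Ct c₀ K₀ T dt N K u f hsym hpos hκA hc hB hCt hT hN hdt hK hK0 hS hq hsch n hn1 hnN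
  have hN' : (0 : ℝ) < N := by exact_mod_cast hN
  have hdtp : 0 < dt := by rw [hdt]; positivity
  have hTN : T = N * dt := by rw [hdt]; field_simp
  have hk : ∀ m : ℕ, m ≤ N → 0 ≤ K ((m : ℝ) * dt) := by
    intro m hm
    refine hK _ ⟨by positivity, ?_⟩
    rw [hTN]
    have : (m : ℝ) ≤ N := by exact_mod_cast hm
    gcongr
  set w : ℕ → V := fun i => (1 / 2 : ℝ) • (u (i + 1) + u i) with hw
  set a : ℕ → ℝ := fun i => Real.sqrt (A (w i) (w i)) with ha
  have key := cn_real κ q c₀ K₀ dt N (fun m => K ((m : ℝ) * dt)) (fun i => ‖u i‖ ^ 2) a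
    (fun i => ‖f (i + 1)‖) hq1 hc hdtp hS hq ?_ n hnN
  · have hsum : ∑ i ∈ Finset.range n, ‖f (i + 1)‖ ^ 2 ≤ ∑ m ∈ Finset.Icc 1 N, ‖f m‖ ^ 2 := by
      have : ∑ m ∈ Finset.Icc 1 N, ‖f m‖ ^ 2 = ∑ i ∈ Finset.range N, ‖f (i + 1)‖ ^ 2 := by
        rw [Finset.range_eq_Ico, Finset.sum_Ico_add' (fun m => ‖f m‖ ^ 2) 0 N 1]
        rfl
      rw [this]
      exact Finset.sum_le_sum_of_subset_of_nonneg (Finset.range_mono hnN)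
        (fun _ _ _ => by positivity)
    have h0 : 0 ≤ dt * ∑ m ∈ Finset.Icc 1 N, ‖f m‖ ^ 2 := by positivity
    have h1 := mul_le_mul_of_nonneg_left (mul_le_mul_of_nonneg_left hsum hdtp.le) hC
    have h2 : 0 ≤ κ ^ 2 / (2 * (1 - q)) * ‖u 0‖ ^ 2 := by positivity
    linarith
  · intro m hm
    have h := hsch (m + 1) (by omega) (by omega) (w m)
    have hidx : ∑ j ∈ Finset.Icc 1 (m + 1 - 1),
        K ((((m + 1 : ℕ) : ℝ) - (j : ℝ)) * dt) • ((1 / 2 : ℝ) • (u j + u (j - 1)))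
        = ∑ i ∈ Finset.range m, K (((m - i : ℕ) : ℝ) * dt) • w i := by
      have e : Finset.Icc 1 (m + 1 - 1) = Finset.Ico (0 + 1) (m + 1) := rfl
      rw [e, ← Finset.sum_Ico_add' (fun j : ℕ =>
        K ((((m + 1 : ℕ) : ℝ) - (j : ℝ)) * dt) • ((1 / 2 : ℝ) • (u j + u (j - 1)))) 0 m 1,
        ← Finset.range_eq_Ico]
      refine Finset.sum_congr rfl fun i hi => ?_
      rw [Nat.cast_sub (Finset.mem_range.mp hi).le]
      simp only [hw, Nat.add_sub_cancel]
      push_cast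
      congr 3
      ring
    rw [hidx] at h
    simp only [Nat.add_sub_cancel] at h
    change ⟪dt⁻¹ • (u (m + 1) - u m), w m⟫ + A (w m) (w m)
      + B (dt • (∑ i ∈ Finset.range m, K (((m - i : ℕ) : ℝ) * dt) • w i)
        + (dt / 2 * K 0) • w m) (w m) + Ct (w m) (w m) (w m) = ⟪f (m + 1), w m⟫ at h
    rw [hCt, add_zero] at h
    have hin : ⟪dt⁻¹ • (u (m + 1) - u m), w m⟫
        = dt⁻¹ * ((‖u (m + 1)‖ ^ 2 - ‖u m‖ ^ 2) / 2) := by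
      simp only [hw, inner_smul_left, inner_smul_right, inner_sub_left, inner_add_right,
        real_inner_self_eq_norm_sq, real_inner_comm (u m) (u (m + 1))]
      simp
      ring
    have hAa : ∀ i, A (w i) (w i) = a i ^ 2 := fun i => (Real.sq_sqrt (hpos _)).symm
    have hBij : ∀ i, -(B (w i) (w m)) ≤ c₀ * ((a i ^ 2 + a m ^ 2) / 2) := by
      intro i
      have h1 := neg_le_of_abs_le (hB (w i) (w m))
      change -(c₀ * a i * a m) ≤ _ at h1
      nlinarith [mul_nonneg hc.le (sq_nonneg (a i - a m))]
    have hf : ⟪f (m + 1), w m⟫ ≤ κ * ‖f (m + 1)‖ * a m := by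
      have h1 := real_inner_le_norm (f (m + 1)) (w m)
      have h2 := mul_le_mul_of_nonneg_left (hκA (w m)) (norm_nonneg (f (m + 1)))
      change _ ≤ ‖f (m + 1)‖ * (κ * a m) at h2
      linarith
    have hBB : -(B (dt • (∑ i ∈ Finset.range m, K (((m - i : ℕ) : ℝ) * dt) • w i)
        + (dt / 2 * K 0) • w m) (w m)) ≤
        c₀ * dt / 2 * ∑ j ∈ Finset.range (m + 1),
          K (((m - j : ℕ) : ℝ) * dt) * (a j ^ 2 + a m ^ 2) := by
      simp only [map_add, map_smul, map_sum, LinearMap.add_apply, LinearMap.smul_apply,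
        LinearMap.sum_apply, smul_eq_mul]
      have h1 : -∑ i ∈ Finset.range m, K (((m - i : ℕ) : ℝ) * dt) * B (w i) (w m) ≤
          c₀ / 2 * ∑ i ∈ Finset.range m,
            K (((m - i : ℕ) : ℝ) * dt) * (a i ^ 2 + a m ^ 2) := by
        rw [← Finset.sum_neg_distrib, Finset.mul_sum]
        refine Finset.sum_le_sum fun i _ => ?_
        have := mul_le_mul_of_nonneg_left (hBij i) (hk (m - i) (by omega))
        linarith
      have hk0 : 0 ≤ K 0 := by simpa using hk 0 (by omega)
      have h2 := mul_le_mul_of_nonneg_left (hBij m) (mul_nonneg (half_pos hdtp).le hk0)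
      have h3 := mul_le_mul_of_nonneg_left h1 hdtp.le
      have h4 : 0 ≤ dt * K 0 * (c₀ * a m ^ 2) := by positivity
      rw [Finset.sum_range_succ]
      simp only [Nat.sub_self, Nat.cast_zero, zero_mul]
      linarith
    rw [hin, hAa] at h
    have hfin : dt⁻¹ * ((‖u (m + 1)‖ ^ 2 - ‖u m‖ ^ 2) / 2) + a m ^ 2 ≤
        c₀ * dt / 2 * ∑ j ∈ Finset.range (m + 1),
          K (((m - j : ℕ) : ℝ) * dt) * (a j ^ 2 + a m ^ 2) + κ * ‖f (m + 1)‖ * a m := by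
      linarith
    have h5 := mul_le_mul_of_nonneg_left hfin (mul_pos two_pos hdtp).le
    have h6 : 2 * dt * (dt⁻¹ * ((‖u (m + 1)‖ ^ 2 - ‖u m‖ ^ 2) / 2) + a m ^ 2)
        = ‖u (m + 1)‖ ^ 2 - ‖u m‖ ^ 2 + 2 * dt * a m ^ 2 := by
      field_simp
    rw [h6] at h5
    linarith
end
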